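/- Let X be a pointed metric space with base point 0, let 2 ≤ p < ∞, and let Y be a real Banach space that is an L_p-space. Let f : X → Y be a map with f(0) = 0 such that y* ∘ f is Lipschitz for every y* ∈ Y*, and let f^a : Y* → X^# denote the linear map f^a(y*) = y* ∘ f. Let K be a set of real-valued functions on X, let R : K × X × X → [0,∞) and S : X × X → [0,∞) be maps satisfying: (I) S(x,q) ≤ ‖f(x) − f(q)‖ for all x, q ∈ X; and (II) every g ∈ f^a(Y*) with Lipschitz norm at most 1 belongs to K and satisfies |g(x) − g(q)| ≤ R(g,x,q) for all x, q ∈ X. If f^a : Y* → X^# is almost p-summing, then there exists a constant C ≥ 0 such that ∑_{i=1}^n S(xᵢ,qᵢ) ≤ C · sup_{g ∈ K} ∑_{i=1}^n R(g,xᵢ,qᵢ) for every n and all x₁,…,xₙ,q₁,…,qₙ ∈ X. -/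

import Mathlib

open scoped BigOperators NNReal

/-- The weak `ℓ_p` norm of a finite family in a normed space. -/
noncomputable def weakNorm (p : ℝ) {E : Type*} [NormedAddCommGroup E] [NormedSpace ℝ E]
    {n : ℕ} (x : Fin n → E) : ℝ :=
  ⨆ φ : {φ : E →L[ℝ] ℝ // ‖φ‖ ≤ 1}, (∑ i, |φ.1 (x i)| ^ p) ^ (1 / p)

/-- The Lipschitz norm of `g : X → ℝ`, i.e. the norm in `X^#`. -/
noncomputable def lipNorm {X : Type*} [MetricSpace X] (g : X → ℝ) : ℝ :=
  sInf {K : ℝ | 0 ≤ K ∧ ∀ x y : X, |g x - g y| ≤ K * dist x y}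

/-- A map `u : E → X^#` (into functions `X → ℝ` measured with the Lipschitz norm) is almost
`p`-summing: there is `C ≥ 0` with
`(2^{-n} ∑_{ε ∈ {−1,1}^n} Lip(∑ εᵢ u(hᵢ))²)^{1/2} ≤ C ‖(hᵢ)‖_{p,w}` for all finite families. -/
def AlmostSummingIntoLip (p : ℝ) {E X : Type*} [NormedAddCommGroup E] [NormedSpace ℝ E]
    [MetricSpace X] (u : E → X → ℝ) : Prop :=
  ∃ C : ℝ, 0 ≤ C ∧ ∀ (n : ℕ) (h : Fin n → E),
    Real.sqrt ((2 ^ n : ℝ)⁻¹ * ∑ ε : Fin n → Bool,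
        lipNorm (fun x : X => ∑ i, (if ε i then (1 : ℝ) else -1) * u (h i) x) ^ 2) ≤
      C * weakNorm p h

/-- The `ℓ_p` norm on `ℝ^m`. -/
noncomputable def lpNorm (p : ℝ) {m : ℕ} (y : Fin m → ℝ) : ℝ :=
  (∑ k, |y k| ^ p) ^ (1 / p)

/-- `Y` is an `L_{p,λ}`-space. -/
def IsLpSpaceWith (p lam : ℝ) (Y : Type*) [NormedAddCommGroup Y] [NormedSpace ℝ Y] : Prop :=
  ∀ E : Submodule ℝ Y, FiniteDimensional ℝ E →
    ∃ Y₀ : Submodule ℝ Y, E ≤ Y₀ ∧ FiniteDimensional ℝ Y₀ ∧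
      ∃ v : Y₀ ≃ₗ[ℝ] (Fin (Module.finrank ℝ Y₀) → ℝ), ∃ a b : ℝ,
        (∀ y : Y₀, lpNorm p (v y) ≤ a * ‖y‖) ∧
        (∀ z : Fin (Module.finrank ℝ Y₀) → ℝ, ‖v.symm z‖ ≤ b * lpNorm p z) ∧
        a * b ≤ lam

open scoped ENNReal

lemma sum_bool_cons {n : ℕ} (F : (Fin (n + 1) → Bool) → ℝ) :
    ∑ ε, F ε = ∑ ε : Fin n → Bool, (F (Fin.cons true ε) + F (Fin.cons false ε)) := by
  rw [← (Fin.consEquiv fun _ => Bool).sum_comp, Fintype.sum_prod_type]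
  simp [Fin.consEquiv, Finset.sum_add_distrib]

/-- The signed sum `∑ εᵢ aᵢ`. -/
noncomputable def signSum {n : ℕ} (a : Fin n → ℝ) (ε : Fin n → Bool) : ℝ :=
  ∑ i, (if ε i then (1 : ℝ) else -1) * a i

lemma signSum_cons {n : ℕ} (a : Fin (n + 1) → ℝ) (b : Bool) (ε : Fin n → Bool) :
    signSum a (Fin.cons b ε) = (if b then (1 : ℝ) else -1) * a 0 + signSum (Fin.tail a) ε := by
  simp [signSum, Fin.sum_univ_succ, Fin.tail]

lemma sum_signSum_sq {n : ℕ} (a : Fin n → ℝ) :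
    ∑ ε, signSum a ε ^ 2 = 2 ^ n * ∑ i, a i ^ 2 := by
  induction n with
  | zero => simp [signSum]
  | succ n ih =>
    have h : ∀ ε : Fin n → Bool, signSum a (Fin.cons true ε) ^ 2
        + signSum a (Fin.cons false ε) ^ 2 = 2 * a 0 ^ 2 + 2 * signSum (Fin.tail a) ε ^ 2 := by
      intro ε
      simp only [signSum_cons, if_true, Bool.false_eq_true, if_false]
      ring
    rw [sum_bool_cons, Finset.sum_congr rfl fun ε _ => h ε, Finset.sum_add_distrib,
      Finset.sum_const, ← Finset.mul_sum, ih, Fin.sum_univ_succ]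
    simp [Fin.tail]
    ring

lemma sum_signSum_pow_four_le {n : ℕ} (a : Fin n → ℝ) :
    ∑ ε, signSum a ε ^ 4 ≤ 2 ^ n * (3 * (∑ i, a i ^ 2) ^ 2) := by
  induction n with
  | zero => simp [signSum]
  | succ n ih =>
    have h : ∀ ε : Fin n → Bool, signSum a (Fin.cons true ε) ^ 4
        + signSum a (Fin.cons false ε) ^ 4 = 2 * a 0 ^ 4 + 12 * a 0 ^ 2 * signSum (Fin.tail a) ε ^ 2
          + 2 * signSum (Fin.tail a) ε ^ 4 := by
      intro ε
      simp only [signSum_cons, if_true, Bool.false_eq_true, if_false]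
      ring
    have hi := ih (Fin.tail a)
    rw [sum_bool_cons, Finset.sum_congr rfl fun ε _ => h ε, Finset.sum_add_distrib,
      Finset.sum_add_distrib, Finset.sum_const, ← Finset.mul_sum, ← Finset.mul_sum, sum_signSum_sq,
      Fin.sum_univ_succ]
    simp only [Finset.card_univ, Fintype.card_pi, Fintype.card_bool,
      Finset.prod_const, Fintype.card_fin, nsmul_eq_mul]
    change _ ≤ 2 ^ (n + 1) * (3 * (a 0 ^ 2 + ∑ i, Fin.tail a i ^ 2) ^ 2)
    push_cast
    have : (0 : ℝ) ≤ 2 ^ n * a 0 ^ 4 := by positivity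
    rw [pow_succ (2 : ℝ) n]
    nlinarith

/-- Khintchine's inequality, comparing the first and second moments of a Rademacher sum. -/
lemma sqrt_sum_sq_le_signSum {n : ℕ} (a : Fin n → ℝ) :
    √(∑ i, a i ^ 2) ≤ 3 * ((2 ^ n : ℝ)⁻¹ * ∑ ε, |signSum a ε|) := by
  set A := ∑ i, a i ^ 2 with hA
  have hA0 : 0 ≤ A := Finset.sum_nonneg fun i _ => sq_nonneg _
  rcases hA0.eq_or_lt with h0 | hpos
  · rw [← h0, Real.sqrt_zero]
    positivity
  set s := √A with hs
  have hspos : 0 < s := Real.sqrt_pos.2 hpos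
  have hss : s ^ 2 = A := Real.sq_sqrt hA0
  have key : ∀ x : ℝ, 2 * (9 * s ^ 2 * x ^ 2 - x ^ 4) ≤ 27 * s ^ 3 * |x| := by
    intro x
    have h2 : x ^ 2 = |x| ^ 2 := (sq_abs x).symm
    have h4 : x ^ 4 = |x| ^ 4 := by rw [show (4 : ℕ) = 2 * 2 by norm_num, pow_mul, h2, ← pow_mul]
    rw [h2, h4]
    set u := |x|
    have hu : 0 ≤ u := abs_nonneg x
    have : 0 ≤ 27 * s ^ 3 - 18 * s ^ 2 * u + 2 * u ^ 3 := by
      nlinarith [mul_nonneg hspos.le (sq_nonneg (u - 2 * s)), mul_nonneg hu (sq_nonneg (u - 2 * s)),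
        pow_pos hspos 3, mul_nonneg hspos.le (sq_nonneg (u - s)), mul_nonneg hu (sq_nonneg (u - s))]
    nlinarith [mul_nonneg hu this]
  have hsum := Finset.sum_le_sum fun (ε : Fin n → Bool) (_ : ε ∈ Finset.univ) => key (signSum a ε)
  rw [← Finset.mul_sum, ← Finset.mul_sum, Finset.sum_sub_distrib, ← Finset.mul_sum,
    sum_signSum_sq, ← hA] at hsum
  have h4 := sum_signSum_pow_four_le a
  rw [← hA] at h4
  have h2n : (0 : ℝ) < 2 ^ n := by positivity
  set T := ∑ ε, |signSum a ε|
  have h5 : s ^ 3 * (2 ^ n * s) ≤ s ^ 3 * (3 * T) := by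
    rw [← hss] at h4 hsum
    have : 0 ≤ s ^ 3 * T := by positivity
    nlinarith
  have h6 := le_of_mul_le_mul_left h5 (by positivity)
  rw [← mul_assoc, mul_comm 3, mul_assoc, inv_mul_eq_div, le_div_iff₀ h2n]
  linarith

lemma rpow_sum_rpow_le_sqrt {n : ℕ} {p : ℝ} (hp : 2 ≤ p) (a : Fin n → ℝ) :
    (∑ i, |a i| ^ p) ^ (1 / p) ≤ √(∑ i, a i ^ 2) := by
  set A := ∑ i, a i ^ 2 with hA
  have hA0 : 0 ≤ A := Finset.sum_nonneg fun i _ => sq_nonneg _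
  set s := √A with hs
  have hs0 : 0 ≤ s := Real.sqrt_nonneg A
  have h : ∀ i, |a i| ^ p ≤ a i ^ 2 * s ^ (p - 2) := by
    intro i
    rw [show p = 2 + (p - 2) by ring, Real.rpow_add_of_nonneg (abs_nonneg _) (by norm_num)
      (by linarith), Real.rpow_two, sq_abs, add_sub_cancel_left]
    gcongr
    exact Real.abs_le_sqrt (Finset.single_le_sum (f := fun i => a i ^ 2)
      (fun i _ => sq_nonneg _) (Finset.mem_univ i))
  have hsum : ∑ i, |a i| ^ p ≤ s ^ p := by
    refine (Finset.sum_le_sum fun i _ => h i).trans_eq ?_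
    rw [← Finset.sum_mul, ← hA, ← Real.sq_sqrt hA0, ← Real.rpow_two,
      ← Real.rpow_add_of_nonneg hs0 (by norm_num) (by linarith), add_sub_cancel]
  calc _ ≤ (s ^ p) ^ (1 / p) := by gcongr
    _ = s := by rw [← Real.rpow_mul hs0, mul_one_div_cancel (by linarith), Real.rpow_one]

lemma exists_int_abs_sub_div_mul_le {N : ℕ} (hN : 0 < N) {x W : ℝ} (h : |x| ≤ W) :
    ∃ j : Finset.Icc (-N : ℤ) N, |x - (j : ℤ) / N * W| ≤ 1 / N * |W| := by
  have hN' : (0 : ℝ) < N := by exact_mod_cast hN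
  rcases ((abs_nonneg x).trans h).eq_or_lt with h0 | hW
  · refine ⟨⟨0, by simp⟩, ?_⟩
    rw [← h0] at h ⊢
    simpa using h
  · obtain ⟨h1, h2⟩ := abs_le.1 h
    refine ⟨⟨⌊N * (x / W)⌋, Finset.mem_Icc.2 ⟨Int.le_floor.2 ?_, ?_⟩⟩, ?_⟩
    · have : -1 ≤ x / W := by rw [le_div_iff₀ hW]; linarith
      push_cast
      nlinarith
    · have : x / W ≤ 1 := by rw [div_le_one hW]; exact h2
      have : (⌊N * (x / W)⌋ : ℝ) ≤ N := (Int.floor_le _).trans (by nlinarith)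
      exact_mod_cast this
    · set t := (⌊N * (x / W)⌋ : ℝ)
      have e : x - t / N * W = (N * (x / W) - t) * (1 / N * W) := by field_simp
      have h3 : 0 ≤ N * (x / W) - t := by linarith [Int.floor_le (N * (x / W))]
      have h4 : N * (x / W) - t ≤ 1 := by linarith [Int.lt_floor_add_one (N * (x / W))]
      have h5 : 0 ≤ 1 / N * W := by positivity
      change |x - t / N * W| ≤ _
      rw [e, abs_of_nonneg (mul_nonneg h3 h5),
        abs_of_pos hW]
      exact mul_le_of_le_one_left h5 h4

section PiLp

variable {q : ℝ≥0∞} [Fact (1 ≤ q)] {κ ι : Type*} [Fintype κ] [Fintype ι]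

lemma piLp_norm_mono (hq : q ≠ ∞) {x y : PiLp q fun _ : κ => ℝ} (h : ∀ k, |x k| ≤ |y k|) :
    ‖x‖ ≤ ‖y‖ := by
  have hq0 : 0 < q.toReal := ENNReal.toReal_pos (zero_lt_one.trans_le Fact.out).ne' hq
  rw [PiLp.norm_eq_sum hq0, PiLp.norm_eq_sum hq0]
  gcongr with k
  exact h k

open Classical in
/-- The restriction of a vector to the cell `c ⁻¹ {j}` of a partition of the coordinates. -/
noncomputable def cellRestrict (q : ℝ≥0∞) (c : κ → ι) (j : ι) :
    (PiLp q fun _ : κ => ℝ) →ₗ[ℝ] PiLp q fun _ : κ => ℝ where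
  toFun z := WithLp.toLp q fun k => if c k = j then z k else 0
  map_add' x y := by ext k; by_cases h : c k = j <;> simp [h]
  map_smul' r x := by ext k; by_cases h : c k = j <;> simp [h]

omit [Fact (1 ≤ q)] [Fintype κ] [Fintype ι] in
open Classical in
lemma cellRestrict_apply (c : κ → ι) (j : ι) (z : PiLp q fun _ : κ => ℝ) (k : κ) :
    cellRestrict q c j z k = if c k = j then z k else 0 := rfl

lemma norm_toLp_norm_cellRestrict (hq : q ≠ ∞) (c : κ → ι) (z : PiLp q fun _ : κ => ℝ) :
    ‖(WithLp.toLp q fun j => ‖cellRestrict q c j z‖ : PiLp q fun _ : ι => ℝ)‖ = ‖z‖ := by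
  classical
  have hq0 : 0 < q.toReal := ENNReal.toReal_pos (zero_lt_one.trans_le Fact.out).ne' hq
  rw [PiLp.norm_eq_sum hq0, PiLp.norm_eq_sum hq0]
  congr 1
  have h : ∀ j, ‖‖cellRestrict q c j z‖‖ ^ q.toReal
      = ∑ k, if c k = j then ‖z k‖ ^ q.toReal else 0 := by
    intro j
    rw [norm_norm, PiLp.norm_eq_sum hq0, ← Real.rpow_mul (by positivity),
      one_div_mul_cancel hq0.ne', Real.rpow_one]
    refine Finset.sum_congr rfl fun k _ => ?_
    rw [cellRestrict_apply]
    split_ifs <;> simp [hq0.ne']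
  simp only [h]
  rw [Finset.sum_comm]
  simp

/-- Collapsing each cell of a partition of the coordinates of `ℓ_q^κ` to a single coordinate is
contractive, and almost isometric on vectors which are nearly proportional to `W` on each cell. -/
lemma exists_cell_collapse (hq : q ≠ ∞) (c : κ → ι) (W : PiLp q fun _ : κ => ℝ) :
    ∃ P : (PiLp q fun _ : κ => ℝ) →ₗ[ℝ] PiLp q fun _ : ι => ℝ, (∀ z, ‖P z‖ ≤ ‖z‖) ∧
      ∀ (w : PiLp q fun _ : κ => ℝ) (r : ι → ℝ) (δ : ℝ), 0 ≤ δ →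
        (∀ k, |w k - r (c k) * W k| ≤ δ * |W k|) → ‖w‖ ≤ ‖P w‖ + 2 * δ * ‖W‖ := by
  choose g hg hgW using fun j => exists_dual_vector'' ℝ (cellRestrict q c j W)
  let P : (PiLp q fun _ : κ => ℝ) →ₗ[ℝ] PiLp q fun _ : ι => ℝ :=
    { toFun := fun z => WithLp.toLp q fun j => g j (cellRestrict q c j z)
      map_add' := fun x y => by ext j; simp
      map_smul' := fun r x => by ext j; simp }
  have hP : ∀ z j, P z j = g j (cellRestrict q c j z) := fun _ _ => rfl
  have hgle : ∀ j z, |g j z| ≤ ‖z‖ := fun j z =>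
    ((g j).le_opNorm z).trans (mul_le_of_le_one_left (norm_nonneg z) (hg j))
  refine ⟨P, fun z => ?_, fun w r δ hδ hw => ?_⟩
  · rw [← norm_toLp_norm_cellRestrict hq c z]
    refine piLp_norm_mono hq fun j => ?_
    rw [hP]
    simpa using hgle j _
  · let A : PiLp q fun _ : ι => ℝ := WithLp.toLp q fun j => |P w j|
    let B : PiLp q fun _ : ι => ℝ := WithLp.toLp q fun j => ‖cellRestrict q c j W‖
    have hA : ‖A‖ ≤ ‖P w‖ := piLp_norm_mono hq fun j => by simp [A]
    have hB : ‖B‖ = ‖W‖ := norm_toLp_norm_cellRestrict hq c W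
    have hcell : ∀ j, ‖cellRestrict q c j w‖ ≤ |P w j| + 2 * δ * ‖cellRestrict q c j W‖ := by
      intro j
      have hd : ‖cellRestrict q c j w - r j • cellRestrict q c j W‖
          ≤ δ * ‖cellRestrict q c j W‖ := by
        rw [← abs_of_nonneg hδ, ← Real.norm_eq_abs, ← norm_smul]
        refine piLp_norm_mono hq fun k => ?_
        simp only [PiLp.sub_apply, PiLp.smul_apply, cellRestrict_apply, smul_eq_mul, abs_mul,
          abs_of_nonneg hδ]
        split_ifs with hk
        · rw [← hk]; exact hw k
        · simp
      have h1 : P w j = g j (cellRestrict q c j w - r j • cellRestrict q c j W)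
          + r j * ‖cellRestrict q c j W‖ := by
        rw [hP, map_sub, map_smul, hgW]; simp
      have h2 := hgle j (cellRestrict q c j w - r j • cellRestrict q c j W)
      have h3 : ‖cellRestrict q c j w‖ ≤ ‖cellRestrict q c j w - r j • cellRestrict q c j W‖
          + |r j| * ‖cellRestrict q c j W‖ := by
        have := norm_add_le (cellRestrict q c j w - r j • cellRestrict q c j W)
          (r j • cellRestrict q c j W)
        rwa [sub_add_cancel, norm_smul, Real.norm_eq_abs] at this
      have h4 : |r j| * ‖cellRestrict q c j W‖ = |r j * ‖cellRestrict q c j W‖| := by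
        rw [abs_mul, abs_norm]
      have h5 : |r j * ‖cellRestrict q c j W‖| ≤ |P w j|
          + |g j (cellRestrict q c j w - r j • cellRestrict q c j W)| := by
        rw [show r j * ‖cellRestrict q c j W‖ = P w j
          - g j (cellRestrict q c j w - r j • cellRestrict q c j W) by rw [h1]; ring]
        exact abs_sub _ _
      linarith
    calc ‖w‖ = ‖(WithLp.toLp q fun j => ‖cellRestrict q c j w‖ : PiLp q fun _ : ι => ℝ)‖ :=
          (norm_toLp_norm_cellRestrict hq c w).symm
      _ ≤ ‖A + (2 * δ) • B‖ := by
          refine piLp_norm_mono hq fun j => ?_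
          simpa [A, B] using (hcell j).trans (le_abs_self _)
      _ ≤ ‖A‖ + ‖(2 * δ) • B‖ := norm_add_le _ _
      _ ≤ ‖P w‖ + 2 * δ * ‖W‖ := by
          rw [norm_smul, hB, Real.norm_of_nonneg (by positivity)]
          gcongr

/-- Finitely many vectors of `ℓ_q^κ` are almost normed by a contraction into some `ℓ_q^ι`, with
`ι` depending on the number of vectors and the precision but not on `κ`. -/
lemma exists_contraction_almost_norming (hq : q ≠ ∞) {n N : ℕ} (hN : 0 < N)
    (w : Fin n → PiLp q fun _ : κ => ℝ) :
    ∃ P : (PiLp q fun _ : κ => ℝ) →ₗ[ℝ] PiLp q fun _ : Fin n → Finset.Icc (-N : ℤ) N => ℝ,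
      (∀ z, ‖P z‖ ≤ ‖z‖) ∧ ∀ i, ‖w i‖ ≤ ‖P (w i)‖ + 2 * (1 / N) * ∑ i, ‖w i‖ := by
  let V : Fin n → PiLp q fun _ : κ => ℝ := fun i => WithLp.toLp q fun k => |w i k|
  have hV : ∀ i, ‖V i‖ ≤ ‖w i‖ := fun i => piLp_norm_mono hq fun k => by simp [V]
  have hW : ∀ i k, |w i k| ≤ (∑ i, V i) k := by
    intro i k
    rw [show (∑ i, V i) k = ∑ i, |w i k| by simp [V]]
    exact Finset.single_le_sum (f := fun i => |w i k|) (fun _ _ => abs_nonneg _)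
      (Finset.mem_univ i)
  choose c hc using fun k i => exists_int_abs_sub_div_mul_le hN (hW i k)
  obtain ⟨P, hP, hPw⟩ := exists_cell_collapse hq c (∑ i, V i)
  refine ⟨P, hP, fun i => (hPw (w i) (fun j => (j i : ℤ) / N) (1 / N) (by positivity)
    fun k => hc k i).trans ?_⟩
  gcongr
  exact (norm_sum_le _ _).trans (Finset.sum_le_sum fun i _ => hV i)

end PiLp

open Filter Topology in
/-- Linear maps into a finite-dimensional space, each bounded by `lam` on a finite set, converge
pointwise along an ultrafilter to a bounded operator. -/
lemma exists_ultrafilter_tendsto_clm {Y G : Type*} [NormedAddCommGroup Y] [NormedSpace ℝ Y]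
    [NormedAddCommGroup G] [NormedSpace ℝ G] [FiniteDimensional ℝ G] {lam : ℝ}
    (V : Finset Y → Y →ₗ[ℝ] G) (hV : ∀ s, ∀ y ∈ s, ‖V s y‖ ≤ lam * ‖y‖) :
    ∃ (U : Ultrafilter (Finset Y)) (T : Y →L[ℝ] G), (∀ y, ‖T y‖ ≤ lam * ‖y‖) ∧
      ∀ y, Tendsto (fun s => V s y) U (𝓝 (T y)) := by
  classical
  have : ProperSpace G := FiniteDimensional.proper_real G
  let U : Ultrafilter (Finset Y) := Ultrafilter.of atTop
  have hU : ∀ y, ∀ᶠ s in (U : Filter (Finset Y)), ‖V s y‖ ≤ lam * ‖y‖ := fun y =>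
    Ultrafilter.of_le (f := atTop) <| (eventually_ge_atTop {y}).mono fun s hs =>
      hV s y (hs (Finset.mem_singleton_self y))
  have hlim : ∀ y, ∃ l, ‖l‖ ≤ lam * ‖y‖ ∧ Tendsto (fun s => V s y) U (𝓝 l) := by
    intro y
    obtain ⟨l, hl, hl'⟩ := (isCompact_closedBall (0 : G) (lam * ‖y‖)).ultrafilter_le_nhds
      (U.map fun s => V s y) (by
        rw [le_principal_iff]
        exact (hU y).mono fun s hs => by simpa using hs)
    exact ⟨l, by simpa using hl, hl'⟩
  choose L hL hLt using hlim
  let T : Y →ₗ[ℝ] G :=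
    { toFun := L
      map_add' := fun x y => tendsto_nhds_unique (hLt (x + y)) <| by
        simpa using (hLt x).add (hLt y)
      map_smul' := fun r x => tendsto_nhds_unique (hLt (r • x)) <| by
        simpa using (hLt x).const_smul r }
  exact ⟨U, T.mkContinuous lam hL, hL, hLt⟩

lemma norm_toLp_eq_lpNorm {p : ℝ} (hp : 0 < p) {m : ℕ} (z : Fin m → ℝ) :
    ‖(WithLp.toLp (ENNReal.ofReal p) z : PiLp (ENNReal.ofReal p) fun _ : Fin m => ℝ)‖
      = lpNorm p z := by
  have h : (ENNReal.ofReal p).toReal = p := ENNReal.toReal_ofReal hp.le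
  rw [PiLp.norm_eq_sum (by rwa [h]), h]
  rfl

lemma IsLpSpaceWith.exists_linearMap {p lam : ℝ} (hp : 0 < p) {Y : Type*} [NormedAddCommGroup Y]
    [NormedSpace ℝ Y] [Fact (1 ≤ ENNReal.ofReal p)] (hY : IsLpSpaceWith p lam Y)
    (E : Submodule ℝ Y) [FiniteDimensional ℝ E] :
    ∃ (m : ℕ) (u : Y →ₗ[ℝ] PiLp (ENNReal.ofReal p) fun _ : Fin m => ℝ),
      ∀ y ∈ E, ‖y‖ ≤ ‖u y‖ ∧ ‖u y‖ ≤ lam * ‖y‖ := by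
  obtain ⟨Y₀, hE, -, v, a, b, ha, hb, hab⟩ := hY E inferInstance
  let u₀ : Y₀ →ₗ[ℝ] PiLp (ENNReal.ofReal p) fun _ : Fin (Module.finrank ℝ Y₀) => ℝ :=
    b • ((WithLp.linearEquiv (ENNReal.ofReal p) ℝ _).symm.toLinearMap ∘ₗ v.toLinearMap)
  obtain ⟨u, hu⟩ := u₀.exists_extend
  refine ⟨_, u, fun y hy => ?_⟩
  rcases eq_or_ne y 0 with rfl | hy0
  · simp
  · let z : Y₀ := ⟨y, hE hy⟩
    have huy : u y = b • WithLp.toLp (ENNReal.ofReal p) (v z) := LinearMap.congr_fun hu z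
    have hypos : 0 < ‖y‖ := norm_pos_iff.2 hy0
    have h1 : ‖y‖ ≤ b * lpNorm p (v z) := by simpa [z] using hb (v z)
    have hlp : 0 ≤ lpNorm p (v z) := by rw [← norm_toLp_eq_lpNorm hp]; exact norm_nonneg _
    have hbpos : 0 < b := pos_of_mul_pos_left (hypos.trans_le h1) hlp
    have hn : ‖u y‖ = b * lpNorm p (v z) := by
      rw [huy, norm_smul, norm_toLp_eq_lpNorm hp, Real.norm_of_nonneg hbpos.le]
    rw [hn]
    refine ⟨h1, ?_⟩
    calc b * lpNorm p (v z) ≤ b * (a * ‖y‖) := by gcongr; exact ha z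
      _ = a * b * ‖y‖ := by ring
      _ ≤ lam * ‖y‖ := by gcongr

/-- A finite family in an `L_p`-space is normed, on average, by a single operator into some
`ℓ_p^M`, with a bound on the operator that is independent of the family. -/
lemma IsLpSpaceWith.exists_clm_norming {p lam : ℝ} (hp : 0 < p) {Y : Type*}
    [NormedAddCommGroup Y] [NormedSpace ℝ Y] [Fact (1 ≤ ENNReal.ofReal p)]
    (hY : IsLpSpaceWith p lam Y) (hlam : 0 ≤ lam) {n : ℕ} (y : Fin n → Y) :
    ∃ (M : ℕ) (T : Y →L[ℝ] PiLp (ENNReal.ofReal p) fun _ : Fin M => ℝ),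
      (∀ z, ‖T z‖ ≤ lam * ‖z‖) ∧ ∑ i, ‖y i‖ ≤ 2 * ∑ i, ‖T (y i)‖ := by
  obtain ⟨N, hN⟩ := exists_nat_gt (4 * n * lam)
  have hN0' : (0 : ℝ) < N := lt_of_le_of_lt (by positivity) hN
  have hN0 : 0 < N := by exact_mod_cast hN0'
  have hV : ∀ s : Finset Y, ∃ V : Y →ₗ[ℝ] PiLp (ENNReal.ofReal p)
      fun _ : Fin n → Finset.Icc (-N : ℤ) N => ℝ,
      (∀ z ∈ s, ‖V z‖ ≤ lam * ‖z‖) ∧ ∑ i, ‖y i‖ ≤ 2 * ∑ i, ‖V (y i)‖ := by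
    intro s
    have hfin : ((s : Set Y) ∪ Set.range y).Finite := s.finite_toSet.union (Set.finite_range y)
    have := FiniteDimensional.span_of_finite ℝ hfin
    obtain ⟨m, u, hu⟩ := hY.exists_linearMap hp (Submodule.span ℝ ((s : Set Y) ∪ Set.range y))
    obtain ⟨P, hP, hPw⟩ := exists_contraction_almost_norming ENNReal.ofReal_ne_top hN0
      fun i => u (y i)
    have hy : ∀ i, y i ∈ Submodule.span ℝ ((s : Set Y) ∪ Set.range y) := fun i =>
      Submodule.subset_span (Or.inr ⟨i, rfl⟩)
    refine ⟨P ∘ₗ u, fun z hz => (hP _).trans (hu z (Submodule.subset_span (Or.inl hz))).2, ?_⟩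
    set A := ∑ i, ‖y i‖ with hA
    have hA0 : 0 ≤ A := Finset.sum_nonneg fun i _ => norm_nonneg _
    have hsum : ∑ i, ‖u (y i)‖ ≤ lam * A := by
      rw [hA, Finset.mul_sum]
      exact Finset.sum_le_sum fun i _ => (hu _ (hy i)).2
    have hle : ∀ i, ‖y i‖ ≤ ‖(P ∘ₗ u) (y i)‖ + 2 * (1 / N) * (lam * A) := fun i =>
      (hu _ (hy i)).1.trans <| (hPw i).trans <| by
        rw [LinearMap.comp_apply]
        gcongr
    have h := Finset.sum_le_sum fun i (_ : i ∈ Finset.univ) => hle i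
    rw [Finset.sum_add_distrib, ← hA, Finset.sum_const, Finset.card_univ, Fintype.card_fin,
      nsmul_eq_mul] at h
    have hsmall : n * (2 * (1 / N) * (lam * A)) ≤ A / 2 := by
      have : n * (2 * (1 / N) * (lam * A)) = 4 * n * lam / N * (A / 2) := by ring
      rw [this]
      exact mul_le_of_le_one_left (by positivity) ((div_le_one hN0').2 hN.le)
    linarith
  choose V hVs hVy using hV
  obtain ⟨U, T, hT, hlim⟩ := exists_ultrafilter_tendsto_clm V hVs
  let e := LinearIsometryEquiv.piLpCongrLeft (ENNReal.ofReal p) ℝ ℝ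
    (Fintype.equivFin (Fin n → Finset.Icc (-N : ℤ) N))
  refine ⟨_, e.toContinuousLinearEquiv.toContinuousLinearMap ∘L T, fun z => ?_, ?_⟩
  · simpa using hT z
  · have := ge_of_tendsto' ((tendsto_finsetSum Finset.univ fun i _ =>
      (hlim (y i)).norm).const_mul 2) hVy
    simpa using this

lemma weakNorm_coord_le {p lam : ℝ} (hp : 0 < p) {Y : Type*} [NormedAddCommGroup Y]
    [NormedSpace ℝ Y] [Fact (1 ≤ ENNReal.ofReal p)] (hlam : 0 ≤ lam) {M : ℕ}
    (T : Y →L[ℝ] PiLp (ENNReal.ofReal p) fun _ : Fin M => ℝ) (hT : ∀ z, ‖T z‖ ≤ lam * ‖z‖) :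
    weakNorm p (fun k => (PiLp.proj (𝕜 := ℝ) (ENNReal.ofReal p) (fun _ : Fin M => ℝ) k) ∘L T)
      ≤ lam := by
  set h := fun k => (PiLp.proj (𝕜 := ℝ) (ENNReal.ofReal p) (fun _ : Fin M => ℝ) k) ∘L T
  refine Real.iSup_le (fun ⟨φ, hφ⟩ => ?_) hlam
  let z : PiLp (ENNReal.ofReal p) fun _ : Fin M => ℝ :=
    WithLp.toLp _ fun k => φ (h k)
  obtain ⟨g, hg, hgz⟩ := exists_dual_vector'' ℝ z
  have hz : (∑ k, |φ (h k)| ^ p) ^ (1 / p) = ‖z‖ := (norm_toLp_eq_lpNorm hp _).symm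
  have hrep : ∀ x : PiLp (ENNReal.ofReal p) fun _ : Fin M => ℝ,
      g x = ∑ k, x k * g (PiLp.single (ENNReal.ofReal p) k 1) := by
    intro x
    conv_lhs => rw [show x = ∑ k, x k • PiLp.single (ENNReal.ofReal p) k (1 : ℝ) by
      ext j; simp [Pi.single_apply]]
    simp
  have hgT : g ∘L T = ∑ k, g (PiLp.single (ENNReal.ofReal p) k 1) • h k := by
    ext x
    simp [h, hrep (T x), mul_comm]
  have hgz' : g z = φ (g ∘L T) := by
    rw [hrep z, hgT]
    simp [z, mul_comm]
  change (∑ k, |φ (h k)| ^ p) ^ (1 / p) ≤ lam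
  rw [hz, show ‖z‖ = g z from hgz.symm, hgz']
  calc φ (g ∘L T) ≤ ‖φ (g ∘L T)‖ := Real.le_norm_self _
    _ ≤ ‖φ‖ * ‖g ∘L T‖ := φ.le_opNorm _
    _ ≤ 1 * (1 * lam) := by
        gcongr
        refine (g.opNorm_comp_le T).trans ?_
        gcongr
        exact T.opNorm_le_bound hlam hT
    _ = lam := by ring

lemma lipNorm_nonneg {X : Type*} [MetricSpace X] (g : X → ℝ) : 0 ≤ lipNorm g :=
  Real.sInf_nonneg fun _ hx => hx.1

lemma lipschitzWith_inv_smul {X : Type*} [MetricSpace X] {g : X → ℝ} {L : ℝ≥0}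
    (hL : LipschitzWith L g) {t : ℝ} (ht : lipNorm g < t) :
    LipschitzWith 1 fun x => t⁻¹ * g x := by
  have ht0 : 0 < t := (lipNorm_nonneg g).trans_lt ht
  obtain ⟨k, ⟨hk0, hk⟩, hkt⟩ := exists_lt_of_csInf_lt
    (s := {K : ℝ | 0 ≤ K ∧ ∀ x y : X, |g x - g y| ≤ K * dist x y})
    ⟨L, L.2, fun x y => by simpa [Real.dist_eq] using hL.dist_le_mul x y⟩ ht
  refine LipschitzWith.of_dist_le_mul fun x y => ?_
  rw [Real.dist_eq, ← mul_sub, abs_mul, abs_of_pos (inv_pos.2 ht0), inv_mul_le_iff₀ ht0,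
    NNReal.coe_one, one_mul]
  exact (hk x y).trans (by gcongr)

/-- **Abstract Kwapień-type theorem for `L_p`-spaces.** Let `X` be a pointed metric space,
`2 ≤ p < ∞`, `Y` a real Banach `L_p`-space and `f : X → Y` with `f base = 0` such that
`ψ ∘ f` is Lipschitz for every `ψ ∈ Y*`; let `f^a : Y* → X^#` be `f^a(ψ) = ψ ∘ f`.
If `R`, `S` satisfy (I) `S(x,q) ≤ ‖f(x) − f(q)‖`, and (II) every `g ∈ f^a(Y*)` of Lipschitz
norm at most `1` lies in `K` and satisfies `|g(x) − g(q)| ≤ R(g,x,q)`, and `f^a` is almost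
`p`-summing, then there is `C ≥ 0` with `∑ S(xᵢ,qᵢ) ≤ C ⬝ sup_{g ∈ K} ∑ R(g,xᵢ,qᵢ)`
(formulated via arbitrary upper bounds `B` of the quantity `∑ R(g,xᵢ,qᵢ)`, `g ∈ K`). -/
theorem abstract_kwapien_Lp {X Y : Type*} [MetricSpace X] (base : X)
    [NormedAddCommGroup Y] [NormedSpace ℝ Y] [CompleteSpace Y]
    (p : ℝ) (hp : 2 ≤ p) (hY : ∃ lam : ℝ, 1 < lam ∧ IsLpSpaceWith p lam Y)
    (f : X → Y) (hf0 : f base = 0)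
    (hlip : ∀ ψ : Y →L[ℝ] ℝ, ∃ L : ℝ≥0, LipschitzWith L (fun x => ψ (f x)))
    (K : Set (X → ℝ)) (R : (X → ℝ) → X → X → ℝ) (S : X → X → ℝ)
    (hRnonneg : ∀ g ∈ K, ∀ x q : X, 0 ≤ R g x q)
    (hSnonneg : ∀ x q : X, 0 ≤ S x q)
    (hI : ∀ x q : X, S x q ≤ ‖f x - f q‖)
    (hII : ∀ ψ : Y →L[ℝ] ℝ, LipschitzWith 1 (fun x => ψ (f x)) →
      (fun x => ψ (f x)) ∈ K ∧ ∀ x q : X, |ψ (f x) - ψ (f q)| ≤ R (fun x => ψ (f x)) x q)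
    (hfa : AlmostSummingIntoLip p (fun ψ : Y →L[ℝ] ℝ => fun x => ψ (f x))) :
    ∃ C : ℝ, 0 ≤ C ∧ ∀ (n : ℕ) (x q : Fin n → X) (B : ℝ),
      (∀ g ∈ K, ∑ i, R g (x i) (q i) ≤ B) →
      ∑ i, S (x i) (q i) ≤ C * B := by
  obtain ⟨lam, hlam1, hlam⟩ := hY
  obtain ⟨C, hC0, hC⟩ := hfa
  have hlam0 : 0 ≤ lam := by linarith
  have hp0 : 0 < p := by linarith
  have : Fact (1 ≤ ENNReal.ofReal p) := ⟨ENNReal.one_le_ofReal.2 (by linarith)⟩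
  refine ⟨6 * (C * lam), by positivity, fun n x q B hB => ?_⟩
  have hB0 : 0 ≤ B := by
    have h0 := (hII 0 (by simpa using LipschitzWith.const' (0 : ℝ))).1
    exact (Finset.sum_nonneg fun i _ => hRnonneg _ h0 _ _).trans (hB _ h0)
  have hψ : ∀ ψ : Y →L[ℝ] ℝ,
      ∑ i, |ψ (f (x i) - f (q i))| ≤ lipNorm (fun x => ψ (f x)) * B := by
    intro ψ
    obtain ⟨L, hL⟩ := hlip ψ
    have ht : ∀ t, lipNorm (fun x => ψ (f x)) < t → ∑ i, |ψ (f (x i) - f (q i))| ≤ t * B := by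
      intro t ht
      have ht0 : 0 < t := (lipNorm_nonneg _).trans_lt ht
      obtain ⟨h1, h2⟩ := hII (t⁻¹ • ψ) (by simpa using lipschitzWith_inv_smul hL ht)
      have h3 := (Finset.sum_le_sum fun i (_ : i ∈ Finset.univ) => h2 (x i) (q i)).trans (hB _ h1)
      rw [← inv_mul_le_iff₀ ht0, Finset.mul_sum]
      refine le_of_eq_of_le (Finset.sum_congr rfl fun i _ => ?_) h3
      rw [← map_sub, smul_apply, smul_eq_mul, abs_mul, abs_of_pos (inv_pos.2 ht0)]
    have hcont : Filter.Tendsto (fun t : ℝ => t * B)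
        (nhdsWithin (lipNorm fun x => ψ (f x)) (Set.Ioi (lipNorm fun x => ψ (f x)))) (nhds _) :=
      (Filter.tendsto_id.mono_right nhdsWithin_le_nhds).mul_const B
    exact ge_of_tendsto hcont (Filter.eventually_of_mem self_mem_nhdsWithin ht)
  obtain ⟨M, T, hT, hTy⟩ := hlam.exists_clm_norming hp0 hlam0 fun i => f (x i) - f (q i)
  let h : Fin M → Y →L[ℝ] ℝ :=
    fun k => (PiLp.proj (𝕜 := ℝ) (ENNReal.ofReal p) (fun _ : Fin M => ℝ) k) ∘L T
  let ψ : (Fin M → Bool) → Y →L[ℝ] ℝ := fun ε => ∑ k, (if ε k then (1 : ℝ) else -1) • h k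
  have hψ_apply : ∀ ε y, ψ ε y = signSum (fun k => T y k) ε := by
    intro ε y
    simp only [ψ, sum_apply, smul_apply, smul_eq_mul, signSum]
    rfl
  let l : (Fin M → Bool) → ℝ := fun ε => lipNorm fun x => ψ ε (f x)
  have hl : (2 ^ M : ℝ)⁻¹ * ∑ ε, l ε ≤ C * lam := by
    have h1 := (hC M h).trans
      (mul_le_mul_of_nonneg_left (weakNorm_coord_le hp0 hlam0 T hT) hC0)
    refine le_trans (Real.le_sqrt_of_sq_le ?_) h1
    have h2 : ∀ ε, (fun x : X => ∑ i, (if ε i then (1 : ℝ) else -1) * h i (f x))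
        = fun x => ψ ε (f x) := by
      intro ε
      funext x
      simp only [ψ, sum_apply, smul_apply, smul_eq_mul]
    simp only [h2]
    change _ ≤ (2 ^ M : ℝ)⁻¹ * ∑ ε, l ε ^ 2
    have h3 := sq_sum_le_card_mul_sum_sq (s := Finset.univ) (f := l)
    simp only [Finset.card_univ, Fintype.card_pi, Fintype.card_bool, Finset.prod_const,
      Fintype.card_fin, Nat.cast_pow, Nat.cast_ofNat] at h3
    rw [mul_pow, sq (2 ^ M : ℝ)⁻¹, mul_assoc]
    gcongr
    rwa [inv_mul_le_iff₀ (by positivity)]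
  have hkh : ∀ y, ‖T y‖ ≤ 3 * ((2 ^ M : ℝ)⁻¹ * ∑ ε, |ψ ε y|) := by
    intro y
    simp only [hψ_apply]
    exact (norm_toLp_eq_lpNorm hp0 fun k => T y k).trans_le <|
      (rpow_sum_rpow_le_sqrt hp _).trans (sqrt_sum_sq_le_signSum _)
  calc ∑ i, S (x i) (q i) ≤ ∑ i, ‖f (x i) - f (q i)‖ := Finset.sum_le_sum fun i _ => hI _ _
    _ ≤ 2 * ∑ i, ‖T (f (x i) - f (q i))‖ := hTy
    _ ≤ 2 * ∑ i, 3 * ((2 ^ M : ℝ)⁻¹ * ∑ ε, |ψ ε (f (x i) - f (q i))|) := by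
        gcongr
        exact hkh _
    _ = 6 * ((2 ^ M : ℝ)⁻¹ * ∑ ε, ∑ i, |ψ ε (f (x i) - f (q i))|) := by
        rw [Finset.sum_comm, ← Finset.mul_sum, ← Finset.mul_sum]
        ring
    _ ≤ 6 * ((2 ^ M : ℝ)⁻¹ * ∑ ε, l ε * B) := by
        gcongr
        exact hψ _
    _ = 6 * ((2 ^ M : ℝ)⁻¹ * ∑ ε, l ε) * B := by
        rw [← Finset.sum_mul]
        ring
    _ ≤ 6 * (C * lam) * B := by gcongr
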